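/- Let f : ℝ² → ℂ be a Schwartz function, ω ∈ ℝ and s ∈ ℝ. Then the Radon transform of f admits the Fourier-domain representation ∫_ℝ f(s θ(ω) + t θ(ω)^⊥) dt = ∫_ℝ e^{i s t} f̂(t θ(ω)) dt, where θ(ω) = (cos ω, sin ω) and θ(ω)^⊥ = (−sin ω, cos ω). -/

import Mathlib

open MeasureTheory Real

/-- The two-dimensional Fourier transform `f̂(ξ) = (2π)⁻¹ ∫ f(x) e^{-i x·ξ} dx`. -/
noncomputable def fourier2 (f : ℝ × ℝ → ℂ) (ξ : ℝ × ℝ) : ℂ :=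
  (2 * π : ℝ)⁻¹ * ∫ x : ℝ × ℝ, f x * Complex.exp (-Complex.I * (x.1 * ξ.1 + x.2 * ξ.2))

open scoped FourierTransform

namespace RadonAux

noncomputable def rotL (ω : ℝ) : ℝ × ℝ →L[ℝ] ℝ × ℝ := fderivPolarCoordSymm (1, ω)

lemma rotL_apply (ω : ℝ) (p : ℝ × ℝ) :
    rotL ω p = (p.1 * cos ω - p.2 * sin ω, p.1 * sin ω + p.2 * cos ω) := by
  unfold rotL fderivPolarCoordSymm
  rw [Matrix.toLin_finTwoProd_toContinuousLinearMap]
  ext <;> simp <;> ring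

lemma rotL_mp (ω : ℝ) : MeasurePreserving (rotL ω) := by
  refine ⟨(rotL ω).continuous.measurable, ?_⟩
  have hd : LinearMap.det (rotL ω : ℝ × ℝ →ₗ[ℝ] ℝ × ℝ) = 1 := det_fderivPolarCoordSymm (1, ω)
  have := Measure.map_linearMap_addHaar_eq_smul_addHaar (μ := (volume : Measure (ℝ × ℝ)))
    (f := (rotL ω : ℝ × ℝ →ₗ[ℝ] ℝ × ℝ)) (by rw [hd]; exact one_ne_zero)
  rw [hd] at this
  simpa using this

lemma rotL_emb (ω : ℝ) : MeasurableEmbedding (rotL ω) := by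
  refine (rotL ω).continuous.measurableEmbedding ?_
  intro p q h
  rw [rotL_apply, rotL_apply, Prod.mk.injEq] at h
  obtain ⟨h1, h2⟩ := h
  have h3 := sin_sq_add_cos_sq ω
  ext
  · linear_combination cos ω * h1 + sin ω * h2 - (p.1 - q.1) * h3
  · linear_combination -sin ω * h1 + cos ω * h2 - (p.2 - q.2) * h3

lemma integrable_rot (f : SchwartzMap (ℝ × ℝ) ℂ) (ω : ℝ) :
    Integrable (fun p => f (rotL ω p)) (volume.prod volume) :=
  ((rotL_mp ω).integrable_comp_emb (rotL_emb ω)).2 (f.integrable (μ := volume))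

lemma bound (f : SchwartzMap (ℝ × ℝ) ℂ) (ω : ℝ) :
    ∃ C : ℝ, ∀ p : ℝ × ℝ, ‖f (rotL ω p)‖ ≤ C * (1 + p.2 ^ 2)⁻¹ := by
  obtain ⟨C0, h0, H0⟩ := f.decay 0 0
  obtain ⟨C2, h2, H2⟩ := f.decay 2 0
  refine ⟨C0 + 2 * C2, fun p => ?_⟩
  have a := H0 (rotL ω p)
  have b := H2 (rotL ω p)
  simp only [norm_iteratedFDeriv_zero, pow_zero, one_mul] at a b
  rw [← div_eq_mul_inv, le_div_iff₀ (by positivity)]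
  have c : p.2 ^ 2 ≤ 2 * ‖rotL ω p‖ ^ 2 := by
    have e1 : (rotL ω p).1 ^ 2 ≤ ‖rotL ω p‖ ^ 2 := by
      rw [← sq_abs]; gcongr; exact norm_fst_le (rotL ω p)
    have e2 : (rotL ω p).2 ^ 2 ≤ ‖rotL ω p‖ ^ 2 := by
      rw [← sq_abs]; gcongr; exact norm_snd_le (rotL ω p)
    have e3 : (rotL ω p).1 ^ 2 + (rotL ω p).2 ^ 2 = p.1 ^ 2 + p.2 ^ 2 := by
      rw [rotL_apply]
      linear_combination (p.1 ^ 2 + p.2 ^ 2) * sin_sq_add_cos_sq ω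
    nlinarith [sq_nonneg p.1]
  nlinarith [norm_nonneg (f (rotL ω p))]

noncomputable def g (f : SchwartzMap (ℝ × ℝ) ℂ) (ω r : ℝ) : ℂ := ∫ t : ℝ, f (rotL ω (r, t))

lemma g_cont (f : SchwartzMap (ℝ × ℝ) ℂ) (ω : ℝ) : Continuous (g f ω) := by
  obtain ⟨C, hC⟩ := bound f ω
  refine continuous_of_dominated (bound := fun t => C * (1 + t ^ 2)⁻¹) ?_ ?_ ?_ ?_
  · intro r
    exact (f.continuous.comp ((rotL ω).continuous.comp (by fun_prop))).aestronglyMeasurable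
  · intro r
    exact .of_forall fun t => hC (r, t)
  · exact integrable_inv_one_add_sq.const_mul C
  · exact .of_forall fun t => f.continuous.comp ((rotL ω).continuous.comp (by fun_prop))

lemma g_int (f : SchwartzMap (ℝ × ℝ) ℂ) (ω : ℝ) : Integrable (g f ω) :=
  (integrable_rot f ω).integral_prod_left

/-- `f` transported to the Euclidean plane. -/
noncomputable def h (f : SchwartzMap (ℝ × ℝ) ℂ) : SchwartzMap (WithLp 2 (ℝ × ℝ)) ℂ :=
  SchwartzMap.compCLMOfContinuousLinearEquiv ℂ (WithLp.prodContinuousLinearEquiv 2 ℝ ℝ ℝ) f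

noncomputable def lineL (ω : ℝ) : ℝ →L[ℝ] WithLp 2 (ℝ × ℝ) :=
  (ContinuousLinearMap.id ℝ ℝ).smulRight (WithLp.toLp 2 (cos ω, sin ω))

lemma lineL_anti (ω : ℝ) : AntilipschitzWith 1 (lineL ω) := by
  refine AddMonoidHomClass.antilipschitz_of_bound _ fun x => ?_
  have : ‖(WithLp.toLp 2 (cos ω, sin ω) : WithLp 2 (ℝ × ℝ))‖ = 1 := by
    rw [WithLp.prod_norm_eq_of_L2]
    simp
  simp [lineL, norm_smul, this]

lemma fourier_slice (f : SchwartzMap (ℝ × ℝ) ℂ) (ω u : ℝ) :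
    ∫ x : ℝ × ℝ, f x * Complex.exp (-Complex.I *
      (x.1 * ((2 * π * u * cos ω : ℝ) : ℂ) + x.2 * ((2 * π * u * sin ω : ℝ) : ℂ)))
      = 𝓕 (g f ω) u := by
  rw [← (rotL_mp ω).integral_comp (rotL_emb ω), fourier_real_eq_integral_exp_smul]
  have key : ∀ p : ℝ × ℝ, f (rotL ω p) * Complex.exp (-Complex.I *
      ((rotL ω p).1 * ((2 * π * u * cos ω : ℝ) : ℂ) +
        (rotL ω p).2 * ((2 * π * u * sin ω : ℝ) : ℂ))) =
      Complex.exp (↑(-2 * π * p.1 * u) * Complex.I) * f (rotL ω p) := by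
    intro p
    rw [mul_comm]
    congr 2
    rw [← Complex.ofReal_mul, ← Complex.ofReal_mul, ← Complex.ofReal_add, neg_mul,
      mul_comm Complex.I, ← neg_mul, ← Complex.ofReal_neg]
    congr 2
    rw [rotL_apply]
    linear_combination (-2 * π * u * p.1) * sin_sq_add_cos_sq ω
  simp_rw [key]
  change ∫ p, _ ∂(volume.prod volume) = _
  rw [integral_prod]
  · simp_rw [integral_const_mul]
    rfl
  · refine (integrable_rot f ω).bdd_mul (c := 1) ?_ ?_
    · exact Continuous.aestronglyMeasurable (by fun_prop)
    · exact .of_forall fun p => (Complex.norm_exp_ofReal_mul_I _).le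

lemma fourier_h (f : SchwartzMap (ℝ × ℝ) ℂ) (ω u : ℝ) :
    (𝓕 (h f)) (lineL ω u) = 𝓕 (g f ω) u := by
  rw [← fourier_slice, SchwartzMap.fourier_coe, fourier_eq',
    ← (WithLp.volume_preserving_toLp ℝ ℝ).integral_comp
      (MeasurableEquiv.toLp 2 (ℝ × ℝ)).measurableEmbedding]
  refine integral_congr_ae (.of_forall fun x => ?_)
  simp only [smul_eq_mul]
  rw [mul_comm]
  have hx : h f (WithLp.toLp 2 x) = f x := rfl
  rw [hx]
  congr 2
  simp [lineL, WithLp.prod_inner_apply]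
  ring

lemma Fg_int (f : SchwartzMap (ℝ × ℝ) ℂ) (ω : ℝ) : Integrable (𝓕 (g f ω)) := by
  have := (SchwartzMap.compCLMOfAntilipschitz ℂ (lineL ω).hasTemperateGrowth (lineL_anti ω)
    (𝓕 (h f))).integrable (μ := volume)
  refine this.congr (.of_forall fun u => ?_)
  exact fourier_h f ω u

end RadonAux

open RadonAux in
/-- Fourier-domain representation of the Radon transform of a Schwartz function:
`∫ f(s θ(ω) + t θ(ω)^⊥) dt = ∫ e^{i s t} f̂(t θ(ω)) dt`. -/
theorem radon_eq_integral_fourier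
    (f : SchwartzMap (ℝ × ℝ) ℂ) (ω s : ℝ) :
    ∫ t : ℝ, f (s * Real.cos ω - t * Real.sin ω, s * Real.sin ω + t * Real.cos ω)
      = ∫ t : ℝ, Complex.exp (Complex.I * s * t)
          * fourier2 (⇑f) (t * Real.cos ω, t * Real.sin ω) := by
  have hL : ∫ t : ℝ, f (s * Real.cos ω - t * Real.sin ω, s * Real.sin ω + t * Real.cos ω)
      = g f ω s := by
    unfold g
    simp_rw [rotL_apply]
  have hpi : (0 : ℝ) < 2 * π := by positivity
  have hcv := Measure.integral_comp_mul_left (fun t : ℝ => Complex.exp (Complex.I * s * t)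
          * fourier2 (⇑f) (t * Real.cos ω, t * Real.sin ω)) (2 * π)
  rw [abs_of_pos (inv_pos.2 hpi), eq_inv_smul_iff₀ hpi.ne'] at hcv
  rw [hL, ← (g_cont f ω).fourierInv_fourier_eq (g_int f ω) (Fg_int f ω), ← hcv, fourierInv_eq',
    ← integral_smul]
  refine integral_congr_ae (.of_forall fun u => ?_)
  simp only [fourier2, fourier_slice, smul_eq_mul, Complex.real_smul]
  have e : Complex.exp (↑(2 * π * inner ℝ u s) * Complex.I)
      = Complex.exp (Complex.I * s * ((2 * π * u : ℝ) : ℂ)) := by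
    congr 1
    simp
    ring
  rw [e]
  have : ((2 * π : ℝ) : ℂ) ≠ 0 := by exact_mod_cast hpi.ne'
  rw [Complex.ofReal_inv]
  field_simp
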